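/- arXiv:1710.01864 — 2 statements merged into one kernel-verified Lean document; each statement's English description precedes it below -/
import Mathlib

section
/- There exists a natural number a such that both a and a + 1 occur among the slopes (a_1, …, a_n) if and only if there exists a value v with 1 ≤ v ≤ n − 1 that is attained by 𝔣 at exactly one element of 𝔬 (i.e. card {τ ∈ 𝔬 : 𝔣(τ) = v} = 1). (This is the precise form of the criterion from the paper's Remark on when a formal Lubin–Tate module occurs in Moonen's cascade structure on the local moduli.) -/
/-- Passing from threshold `k + 1` to threshold `k` adds the fibre over `k + 1`. -/
theorem card_filter_lt_eq_add_card_fiber {α : Type*} [Fintype α] (f : α → ℕ) (k : ℕ) :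
    (Finset.univ.filter (fun x => k < f x)).card =
      (Finset.univ.filter (fun x => k + 1 < f x)).card +
        (Finset.univ.filter (fun x => f x = k + 1)).card := by
  classical
  rw [← Finset.card_union_of_disjoint]
  · congr 1
    ext x
    simp only [Finset.mem_filter, Finset.mem_univ, true_and, Finset.mem_union]
    omega
  · rw [Finset.disjoint_filter]
    intro x _ h
    omega

/-- A monotone sequence of naturals that increases by one between `j` and `k` does so in a
single step. -/
theorem Monotone.exists_succ_eq_add_one {a : ℕ → ℕ} (hmono : Monotone a) {j k : ℕ}
    (h : a k = a j + 1) : ∃ i, j ≤ i ∧ i < k ∧ a (i + 1) = a i + 1 := by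
  induction k with
  | zero =>
    have := hmono (Nat.zero_le j)
    omega
  | succ k ih =>
    have hjk : j ≤ k := by
      by_contra! hlt
      have := hmono (show k + 1 ≤ j from hlt)
      omega
    have h₁ := hmono hjk
    have h₂ := hmono (Nat.le_succ k)
    by_cases hk : a k = a j + 1
    · obtain ⟨i, hji, hik, hi⟩ := ih hk
      exact ⟨i, hji, by omega, hi⟩
    · exact ⟨k, hjk, by omega, by simp only [Nat.succ_eq_add_one] at h₂; omega⟩


/-- Criterion for when a formal Lubin–Tate module occurs in Moonen's cascade:
two consecutive integers `a0` and `a0 + 1` both occur among the slopes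
`(a 1, …, a n)` if and only if some value `v` with `1 ≤ v ≤ n − 1` is attained
by `𝔣` at exactly one element of `𝔬`. -/
theorem mu_ordinary_lubin_tate_criterion
    (n e : ℕ) (hn : 1 ≤ n) (he : 1 ≤ e)
    (𝔬 : Type*) [Fintype 𝔬]
    (hcard : Fintype.card 𝔬 = e)
    (𝔣 : 𝔬 → ℕ) (h𝔣 : ∀ τ, 𝔣 τ ≤ n)
    (a : ℕ → ℕ)
    (ha : ∀ j, a j = (Finset.univ.filter (fun τ => n - j < 𝔣 τ)).card) :
    (∃ a0 : ℕ, (∃ j, 1 ≤ j ∧ j ≤ n ∧ a j = a0) ∧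
        (∃ j, 1 ≤ j ∧ j ≤ n ∧ a j = a0 + 1)) ↔
    (∃ v, 1 ≤ v ∧ v ≤ n - 1 ∧
        (Finset.univ.filter (fun τ => 𝔣 τ = v)).card = 1) := by
  have hstep : ∀ j, j + 1 ≤ n →
      a (j + 1) = a j + (Finset.univ.filter (fun τ => 𝔣 τ = n - j)).card := by
    intro j hj
    rw [ha, ha, card_filter_lt_eq_add_card_fiber, show n - (j + 1) + 1 = n - j by omega]
  have hmono : Monotone a := by
    intro i j hij
    rw [ha, ha]
    refine Finset.card_le_card (Finset.monotone_filter_right _ fun τ _ (h : n - i < 𝔣 τ) => ?_)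
    omega
  constructor
  · rintro ⟨_, ⟨j, hj, -, rfl⟩, k, -, hkn, hk⟩
    obtain ⟨i, hji, hik, hi⟩ := hmono.exists_succ_eq_add_one hk
    have := hstep i (by omega)
    exact ⟨n - i, by omega, by omega, by omega⟩
  · rintro ⟨v, hv, hvn, hcv⟩
    have h := hstep (n - v) (by omega)
    rw [show n - (n - v) = v by omega, hcv] at h
    exact ⟨_, ⟨n - v, by omega, by omega, rfl⟩, n - v + 1, by omega, by omega, h⟩
end

section
/- Let p be an odd prime, r ≥ 1, and for each i ∈ Fin r define the ℤ_p-linear operator θ_i on the polynomial ring ℤ_p[X_1, …, X_r] (multivariable polynomials indexed by Fin r) by θ_i(f) := (1 + X_i) · (∂f/∂X_i). Let m ≥ 1 be an integer and let k, k' : Fin r → ℕ satisfy: for every i, p^m(p − 1) divides k(i) − k'(i), and for every i, either k(i) = k'(i) or both k(i) > m and k'(i) > m. Then for every polynomial f, every coefficient of (θ_1^{k(1)} ∘ ⋯ ∘ θ_r^{k(r)})(f) − (θ_1^{k'(1)} ∘ ⋯ ∘ θ_r^{k'(r)})(f) is divisible by p^{m+1}. (This is the multivariable form, on u-expansions, of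 the paper's congruence proposition θ^λ ≡ θ^{λ'} mod p^{m+1} for simple weights λ ≡ λ' mod p^m(p − 1).) -/
open MvPolynomial

/-- The Euler-type operator `f ↦ (1 + X i) * ∂f/∂X i` as a linear map. -/
noncomputable def thetaLin {σ R : Type*} [CommRing R] (i : σ) :
    MvPolynomial σ R →ₗ[R] MvPolynomial σ R :=
  (LinearMap.mulLeft R (1 + X i)).comp (pderiv i).toLinearMap

theorem thetaLin_apply {σ R : Type*} [CommRing R] (i : σ) (f : MvPolynomial σ R) :
    thetaLin i f = (1 + X i) * pderiv i f := rfl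

/-- Under the substitution `X j ↦ 1 + X j`, the operator `thetaLin i` corresponds to
`X i * ∂/∂X i`. -/
theorem thetaLin_aeval_one_add_X {σ R : Type*} [CommRing R] (i : σ) (g : MvPolynomial σ R) :
    thetaLin i (aeval (fun j => (1 + X j : MvPolynomial σ R)) g) =
      aeval (fun j => (1 + X j : MvPolynomial σ R)) (X i * pderiv i g) := by
  classical
  induction g using MvPolynomial.induction_on with
  | C a => simp [thetaLin_apply, MvPolynomial.algebraMap_eq]
  | add f g hf hg => simp only [map_add, mul_add, hf, hg]
  | mul_X f j hf =>
    simp only [thetaLin_apply, map_mul, aeval_X, Derivation.leibniz, smul_eq_mul, map_add,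
      pderiv_X, Derivation.map_one_eq_zero, zero_add] at hf ⊢
    rcases eq_or_ne j i with rfl | h
    · simp only [Pi.single_eq_same, map_one]
      linear_combination (1 + X j) * hf
    · simp only [Pi.single_eq_of_ne h, map_zero]
      linear_combination (1 + X j) * hf

theorem thetaLin_iterate_aeval_monomial {σ R : Type*} [CommRing R] (i : σ) (n : ℕ)
    (d : σ →₀ ℕ) (a : R) :
    (thetaLin i)^[n] (aeval (fun j => (1 + X j : MvPolynomial σ R)) (monomial d a)) =
      ((d i : R) ^ n) • aeval (fun j => (1 + X j : MvPolynomial σ R)) (monomial d a) := by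
  induction n with
  | zero => simp
  | succ n ih =>
    rw [Function.iterate_succ_apply', ih, map_smul, thetaLin_aeval_one_add_X,
      X_mul_pderiv_monomial, map_nsmul, pow_succ, mul_smul, Nat.cast_smul_eq_nsmul]

theorem exists_aeval_one_add_X_eq {σ R : Type*} [CommRing R] (f : MvPolynomial σ R) :
    ∃ g : MvPolynomial σ R, aeval (fun j => (1 + X j : MvPolynomial σ R)) g = f := by
  induction f using MvPolynomial.induction_on with
  | C a => exact ⟨C a, by simp [MvPolynomial.algebraMap_eq]⟩
  | add f g hf hg =>
    obtain ⟨a, rfl⟩ := hf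
    obtain ⟨b, rfl⟩ := hg
    exact ⟨a + b, map_add _ _ _⟩
  | mul_X f j hf =>
    obtain ⟨a, rfl⟩ := hf
    exact ⟨a * (X j - 1), by simp⟩

/-- If `q` divides `n ^ k - n ^ l` for every natural number `n`, then the `k`-th and `l`-th
iterates of `thetaLin i` agree modulo `q`. -/
theorem exists_thetaLin_iterate_sub_eq_smul {σ R : Type*} [CommRing R] (i : σ) {q : R} {k l : ℕ}
    (h : ∀ n : ℕ, q ∣ (n : R) ^ k - (n : R) ^ l) (f : MvPolynomial σ R) :
    ∃ u, (thetaLin i)^[k] f - (thetaLin i)^[l] f = q • u := by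
  obtain ⟨g, rfl⟩ := exists_aeval_one_add_X_eq f
  induction g using MvPolynomial.induction_on' with
  | monomial d a =>
    obtain ⟨c, hc⟩ := h (d i)
    rw [thetaLin_iterate_aeval_monomial, thetaLin_iterate_aeval_monomial, ← sub_smul, hc, mul_smul]
    exact ⟨_, rfl⟩
  | add f g hf hg =>
    obtain ⟨u, hu⟩ := hf
    obtain ⟨v, hv⟩ := hg
    refine ⟨u + v, ?_⟩
    rw [smul_add, ← hu, ← hv, map_add]
    simp only [← Module.End.pow_apply, map_add]
    abel

theorem exists_foldr_thetaLin_sub_eq_smul {σ R : Type*} [CommRing R] {q : R} {k l : σ → ℕ}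
    (h : ∀ i, ∀ n : ℕ, q ∣ (n : R) ^ k i - (n : R) ^ l i) (L : List σ) (f : MvPolynomial σ R) :
    ∃ u, L.foldr (fun i g => (thetaLin i)^[k i] ∘ g) id f -
      L.foldr (fun i g => (thetaLin i)^[l i] ∘ g) id f = q • u := by
  induction L with
  | nil => exact ⟨0, by simp⟩
  | cons i L ih =>
    obtain ⟨u, hu⟩ := ih
    simp only [List.foldr_cons, Function.comp_apply]
    set a := L.foldr (fun i g => (thetaLin i)^[k i] ∘ g) id f
    set b := L.foldr (fun i g => (thetaLin i)^[l i] ∘ g) id f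
    obtain ⟨v, hv⟩ := exists_thetaLin_iterate_sub_eq_smul i (h i) b
    refine ⟨(thetaLin i)^[k i] u + v, ?_⟩
    have hab : (thetaLin i)^[k i] a - (thetaLin i)^[k i] b = q • (thetaLin i)^[k i] u := by
      simp only [← Module.End.pow_apply, ← map_sub, hu, map_smul]
    rw [smul_add, ← hab, ← hv]
    abel

theorem pow_modEq_pow_of_totient_dvd {p m k l n : ℕ} (hp : p.Prime) (hlk : l ≤ k)
    (hdvd : p ^ m * (p - 1) ∣ k - l) (hl : m < l) :
    n ^ l ≡ n ^ k [MOD p ^ (m + 1)] := by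
  by_cases hn : p ∣ n
  · have key : ∀ j, m < j → n ^ j ≡ 0 [MOD p ^ (m + 1)] := fun j hj =>
      (Nat.modEq_zero_iff_dvd).2 ((pow_dvd_pow p hj).trans (pow_dvd_pow_of_dvd hn j))
    exact (key l hl).trans (key k (hl.trans_le hlk)).symm
  · obtain ⟨c, hc⟩ := hdvd
    have hcop : n.Coprime (p ^ (m + 1)) :=
      (((Nat.Prime.coprime_iff_not_dvd hp).2 hn).symm).pow_right _
    have ht := (Nat.ModEq.pow_totient hcop).pow c
    rw [Nat.totient_prime_pow_succ hp, ← pow_mul, ← hc, one_pow] at ht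
    have := (ht.mul_left (n ^ l)).symm
    rwa [← pow_add, Nat.add_sub_cancel' hlk, mul_one] at this

theorem prime_pow_dvd_pow_sub_pow {R : Type*} [CommRing R] {p m k l : ℕ} (hp : p.Prime)
    (hdvd : (p : ℤ) ^ m * ((p : ℤ) - 1) ∣ (k : ℤ) - l) (hbig : k = l ∨ (m < k ∧ m < l)) (n : ℕ) :
    (p : R) ^ (m + 1) ∣ (n : R) ^ k - (n : R) ^ l := by
  rcases hbig with rfl | ⟨hk, hl⟩
  · simp
  wlog hlk : l ≤ k generalizing k l
  · rw [dvd_sub_comm]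
    exact this ((dvd_sub_comm).1 hdvd) hl hk (le_of_not_ge hlk)
  have hdvd' : p ^ m * (p - 1) ∣ k - l := by
    zify [hlk, hp.one_le]
    exact hdvd
  have hz := (pow_modEq_pow_of_totient_dvd (n := n) hp hlk hdvd' hl).dvd
  simpa using map_dvd (Int.castRingHom R) hz


/-- Multivariable form, on u-expansions, of the congruence proposition
`θ^λ ≡ θ^{λ'} mod p^{m+1}` for simple weights `λ ≡ λ' mod p^m (p − 1)`:
with `θ_i f = (1 + X_i) ∂f/∂X_i` on `ℤ_p[X_1, …, X_r]`, if for each `i`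
`p^m (p − 1) ∣ k i − k' i` and either `k i = k' i` or `k i, k' i > m`, then
every coefficient of the difference of the composites
`θ_1^{k 1} ∘ ⋯ ∘ θ_r^{k r}` and `θ_1^{k' 1} ∘ ⋯ ∘ θ_r^{k' r}` applied to any
polynomial is divisible by `p^{m+1}`. -/
theorem theta_multivariable_congruence
    (p : ℕ) [Fact p.Prime] (hp : Odd p)
    (r : ℕ) (hr : 1 ≤ r)
    (θ : Fin r → MvPolynomial (Fin r) ℤ_[p] → MvPolynomial (Fin r) ℤ_[p])
    (hθ : ∀ i f, θ i f = (1 + MvPolynomial.X i) * MvPolynomial.pderiv i f)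
    (m : ℕ) (hm : 1 ≤ m)
    (k k' : Fin r → ℕ)
    (hdvd : ∀ i, ((p : ℤ) ^ m * ((p : ℤ) - 1)) ∣ ((k i : ℤ) - (k' i : ℤ)))
    (hbig : ∀ i, k i = k' i ∨ (m < k i ∧ m < k' i)) :
    ∀ (f : MvPolynomial (Fin r) ℤ_[p]) (d : Fin r →₀ ℕ),
      ((p : ℤ_[p]) ^ (m + 1)) ∣
        MvPolynomial.coeff d
          (((List.finRange r).foldr (fun i g => (θ i)^[k i] ∘ g) id) f -
           ((List.finRange r).foldr (fun i g => (θ i)^[k' i] ∘ g) id) f) := by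
  intro f d
  have hθ' : ∀ i, θ i = thetaLin i := fun i => funext fun g => hθ i g
  have hdiv (i : Fin r) (n : ℕ) :
      (p : ℤ_[p]) ^ (m + 1) ∣ (n : ℤ_[p]) ^ k i - (n : ℤ_[p]) ^ k' i :=
    prime_pow_dvd_pow_sub_pow (Fact.out : p.Prime) (hdvd i) (hbig i) n
  obtain ⟨u, hu⟩ := exists_foldr_thetaLin_sub_eq_smul hdiv (List.finRange r) f
  simp only [hθ']
  rw [hu, MvPolynomial.coeff_smul, smul_eq_mul]
  exact dvd_mul_right _ _
end
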